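/- arXiv:1507.06444 — 6 statements merged into one kernel-verified Lean document; each statement's English description precedes it below -/
import Mathlib

section
/- Let T be a nonempty set, 𝒜 an algebra of subsets of T, and μ : 𝒜 → [0,∞) a set function with μ(∅) = 0. If μ is integrable (i.e. the net of partition sums of μ, directed by refinement of finite partitions, converges), then for every A ∈ 𝒜 the restriction μ_A : B ↦ μ(A ∩ B) is integrable, and the resulting set function Ψ : 𝒜 → [0,∞), Ψ(A) = ∫_A μ, is finitely additive on 𝒜. -/
/-- A finite partition of `S` by nonempty, pairwise disjoint members of the family `𝒜`. -/
def IsFinPart {T : Type*} (𝒜 : Set (Set T)) (S : Set T) {n : ℕ} (A : Fin n → Set T) : Prop :=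
  (∀ i, A i ∈ 𝒜) ∧ (∀ i, (A i).Nonempty) ∧
    (Pairwise fun i j => Disjoint (A i) (A j)) ∧ (⋃ i, A i) = S

/-- The set function `μ` is (Gould) integrable on `S` with integral `l`: the net of
partition sums, directed by refinement of finite partitions of `S`, converges to `l`. -/
def SetFnIntegrableOn {T : Type*} (𝒜 : Set (Set T)) (μ : Set T → ℝ) (S : Set T) (l : ℝ) : Prop :=
  ∀ ε > (0 : ℝ), ∃ (n : ℕ) (P₀ : Fin n → Set T), IsFinPart 𝒜 S P₀ ∧
    ∀ (m : ℕ) (P : Fin m → Set T), IsFinPart 𝒜 S P → (∀ j, ∃ i, P j ⊆ P₀ i) →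
      |(∑ j, μ (P j)) - l| ≤ ε

/-- A finite set of nonempty, pairwise disjoint members of `𝒜` whose union is `S`. -/
structure IsFinsetPart {T : Type*} (𝒜 : Set (Set T)) (S : Set T) (P : Finset (Set T)) : Prop where
  mem : ∀ p ∈ P, p ∈ 𝒜
  nonempty : ∀ p ∈ P, p.Nonempty
  eq_of_mem : ∀ p ∈ P, ∀ q ∈ P, ∀ x, x ∈ p → x ∈ q → p = q
  mem_iff : ∀ x, x ∈ S ↔ ∃ p ∈ P, x ∈ p

/-- `P` refines `Q` if every set of `P` is contained in some set of `Q`. -/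
def FinsetRefines {T : Type*} (P Q : Finset (Set T)) : Prop :=
  ∀ p ∈ P, ∃ q ∈ Q, p ⊆ q

section

variable {T : Type*} {𝒜 : Set (Set T)} {A B S : Set T} {P Q R : Finset (Set T)} {μ : Set T → ℝ}

theorem FinsetRefines.trans (hPQ : FinsetRefines P Q) (hQR : FinsetRefines Q R) :
    FinsetRefines P R := by
  intro p hp
  obtain ⟨q, hq, hpq⟩ := hPQ p hp
  obtain ⟨r, hr, hqr⟩ := hQR q hq
  exact ⟨r, hr, hpq.trans hqr⟩

open Classical in
theorem FinsetRefines.union_left (hP : FinsetRefines P R) (hQ : FinsetRefines Q R) :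
    FinsetRefines (P ∪ Q) R := by
  intro p hp
  rcases Finset.mem_union.1 hp with hp | hp
  exacts [hP p hp, hQ p hp]

theorem IsFinPart.injective {n : ℕ} {p : Fin n → Set T} (hp : IsFinPart 𝒜 S p) :
    Function.Injective p := by
  intro i j hij
  by_contra hne
  have hdisj := hp.2.2.1 hne
  simp only [hij, disjoint_self] at hdisj
  exact (hp.2.1 j).ne_empty hdisj

theorem isFinsetPart_map_iff {n : ℕ} (p : Fin n ↪ Set T) :
    IsFinsetPart 𝒜 S (Finset.univ.map p) ↔ IsFinPart 𝒜 S p := by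
  constructor
  · intro h
    refine ⟨fun i => h.mem _ (by simp), fun i => h.nonempty _ (by simp), fun i j hij => ?_, ?_⟩
    · refine Set.disjoint_left.2 fun x hi hj => ?_
      exact hij (p.injective (h.eq_of_mem _ (by simp) _ (by simp) x hi hj))
    · ext x
      simp [h.mem_iff]
  · rintro ⟨hmem, hne, hdisj, hunion⟩
    refine ⟨by simpa using hmem, by simpa using hne, ?_, fun x => by simp [← hunion]⟩
    simp only [Finset.mem_map, Finset.mem_univ, true_and, forall_exists_index,
      forall_apply_eq_imp_iff]
    intro i j x hi hj
    by_contra hij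
    exact Set.disjoint_left.1 (hdisj fun h => hij (congrArg p h)) hi hj

/-- Every finite set of sets is enumerated by some `Fin n`. -/
theorem exists_map_univ_eq (P : Finset (Set T)) :
    ∃ (n : ℕ) (p : Fin n ↪ Set T), Finset.univ.map p = P := by
  refine ⟨P.card, P.equivFin.symm.toEmbedding.trans (Function.Embedding.subtype _), ?_⟩
  rw [← Finset.map_map, Finset.map_univ_equiv]
  exact P.attach_map_val

theorem setFnIntegrableOn_iff_finset {l : ℝ} :
    SetFnIntegrableOn 𝒜 μ S l ↔ ∀ ε > (0 : ℝ), ∃ P₀, IsFinsetPart 𝒜 S P₀ ∧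
      ∀ P, IsFinsetPart 𝒜 S P → FinsetRefines P P₀ → |(∑ p ∈ P, μ p) - l| ≤ ε := by
  refine forall₂_congr fun ε _ => ⟨?_, ?_⟩
  · rintro ⟨n, p₀, hp₀, h⟩
    refine ⟨Finset.univ.map ⟨p₀, hp₀.injective⟩, (isFinsetPart_map_iff _).2 hp₀, ?_⟩
    intro P hP href
    obtain ⟨m, p, rfl⟩ := exists_map_univ_eq P
    simpa using h m p ((isFinsetPart_map_iff p).1 hP) (by simpa [FinsetRefines] using href)
  · rintro ⟨P₀, hP₀, h⟩
    obtain ⟨n, p₀, rfl⟩ := exists_map_univ_eq P₀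
    refine ⟨n, p₀, (isFinsetPart_map_iff p₀).1 hP₀, fun m p hp href => ?_⟩
    simpa using h (Finset.univ.map ⟨p, hp.injective⟩) ((isFinsetPart_map_iff _).2 hp)
      (by simpa [FinsetRefines] using href)

namespace IsFinsetPart

theorem disjoint (hP : IsFinsetPart 𝒜 A P) (hQ : IsFinsetPart 𝒜 B Q) (hAB : Disjoint A B) :
    Disjoint P Q := by
  rw [Finset.disjoint_left]
  intro p hp hq
  obtain ⟨x, hx⟩ := hP.nonempty p hp
  exact Set.disjoint_left.1 hAB ((hP.mem_iff x).2 ⟨p, hp, hx⟩) ((hQ.mem_iff x).2 ⟨p, hq, hx⟩)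

open Classical in
theorem union (hP : IsFinsetPart 𝒜 A P) (hQ : IsFinsetPart 𝒜 B Q) (hAB : Disjoint A B) :
    IsFinsetPart 𝒜 (A ∪ B) (P ∪ Q) := by
  have hcross : ∀ p ∈ P, ∀ q ∈ Q, ∀ x, x ∈ p → x ∈ q → False := fun p hp q hq x hxp hxq =>
    Set.disjoint_left.1 hAB ((hP.mem_iff x).2 ⟨p, hp, hxp⟩) ((hQ.mem_iff x).2 ⟨q, hq, hxq⟩)
  refine ⟨fun p hp => ?_, fun p hp => ?_, fun p hp q hq x hxp hxq => ?_, fun x => ?_⟩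
  · exact (Finset.mem_union.1 hp).elim (hP.mem p) (hQ.mem p)
  · exact (Finset.mem_union.1 hp).elim (hP.nonempty p) (hQ.nonempty p)
  · rcases Finset.mem_union.1 hp with hp | hp <;> rcases Finset.mem_union.1 hq with hq | hq
    · exact hP.eq_of_mem p hp q hq x hxp hxq
    · exact (hcross p hp q hq x hxp hxq).elim
    · exact (hcross q hq p hp x hxq hxp).elim
    · exact hQ.eq_of_mem p hp q hq x hxp hxq
  · simp only [Set.mem_union, hP.mem_iff, hQ.mem_iff, Finset.mem_union, or_and_right, exists_or]

open Classical in
theorem sum_union (hP : IsFinsetPart 𝒜 A P) (hQ : IsFinsetPart 𝒜 B Q) (hAB : Disjoint A B) :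
    ∑ p ∈ P ∪ Q, μ p = ∑ p ∈ P, μ p + ∑ p ∈ Q, μ p :=
  Finset.sum_union (hP.disjoint hQ hAB)

theorem singleton_of_nonempty (hA : A ∈ 𝒜) (hne : A.Nonempty) : IsFinsetPart 𝒜 A {A} := by
  constructor <;> simp [hA, hne]

/-- Partitions of `S` and of a subset `A` of `S` have a common refinement partitioning `A`. -/
theorem exists_refines (hinter : ∀ A ∈ 𝒜, ∀ B ∈ 𝒜, A ∩ B ∈ 𝒜) (hP : IsFinsetPart 𝒜 S P)
    (hQ : IsFinsetPart 𝒜 A Q) (hAS : A ⊆ S) :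
    ∃ R, IsFinsetPart 𝒜 A R ∧ FinsetRefines R P ∧ FinsetRefines R Q := by
  classical
  have key : ∀ r, r ∈ {r ∈ Finset.image₂ (· ∩ ·) P Q | r.Nonempty} ↔
      (∃ p ∈ P, ∃ q ∈ Q, p ∩ q = r) ∧ r.Nonempty := by
    simp [Finset.mem_image₂]
  refine ⟨{r ∈ Finset.image₂ (· ∩ ·) P Q | r.Nonempty}, ⟨?_, ?_, ?_, ?_⟩, ?_, ?_⟩
  · intro r hr
    obtain ⟨⟨p, hp, q, hq, rfl⟩, -⟩ := (key r).1 hr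
    exact hinter _ (hP.mem p hp) _ (hQ.mem q hq)
  · exact fun r hr => ((key r).1 hr).2
  · intro r hr r' hr' x hx hx'
    obtain ⟨⟨p, hp, q, hq, rfl⟩, -⟩ := (key r).1 hr
    obtain ⟨⟨p', hp', q', hq', rfl⟩, -⟩ := (key r').1 hr'
    rw [hP.eq_of_mem p hp p' hp' x hx.1 hx'.1, hQ.eq_of_mem q hq q' hq' x hx.2 hx'.2]
  · intro x
    constructor
    · intro hx
      obtain ⟨p, hp, hxp⟩ := (hP.mem_iff x).1 (hAS hx)
      obtain ⟨q, hq, hxq⟩ := (hQ.mem_iff x).1 hx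
      exact ⟨p ∩ q, (key _).2 ⟨⟨p, hp, q, hq, rfl⟩, x, hxp, hxq⟩, hxp, hxq⟩
    · rintro ⟨r, hr, hxr⟩
      obtain ⟨⟨p, hp, q, hq, rfl⟩, -⟩ := (key r).1 hr
      exact (hQ.mem_iff x).2 ⟨q, hq, hxr.2⟩
  · intro r hr
    obtain ⟨⟨p, hp, q, hq, rfl⟩, -⟩ := (key r).1 hr
    exact ⟨p, hp, Set.inter_subset_left⟩
  · intro r hr
    obtain ⟨⟨p, hp, q, hq, rfl⟩, -⟩ := (key r).1 hr
    exact ⟨q, hq, Set.inter_subset_right⟩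

/-- A partition of `S` restricts to a partition of any subset `A ∈ 𝒜` of `S`. -/
theorem exists_restrict (hinter : ∀ A ∈ 𝒜, ∀ B ∈ 𝒜, A ∩ B ∈ 𝒜) (hP : IsFinsetPart 𝒜 S P)
    (hA : A ∈ 𝒜) (hAS : A ⊆ S) :
    ∃ R, IsFinsetPart 𝒜 A R ∧ FinsetRefines R P := by
  rcases A.eq_empty_or_nonempty with rfl | hne
  · exact ⟨∅, by constructor <;> simp, by simp [FinsetRefines]⟩
  · obtain ⟨R, hR, hRP, -⟩ := hP.exists_refines hinter (singleton_of_nonempty hA hne) hAS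
    exact ⟨R, hR, hRP⟩

end IsFinsetPart

/-- Cauchy criterion for the net of partition sums. -/
theorem exists_setFnIntegrableOn_of_cauchy (hinter : ∀ A ∈ 𝒜, ∀ B ∈ 𝒜, A ∩ B ∈ 𝒜)
    (h : ∀ ε > (0 : ℝ), ∃ P₀, IsFinsetPart 𝒜 S P₀ ∧
      ∀ P, IsFinsetPart 𝒜 S P → FinsetRefines P P₀ → |∑ p ∈ P, μ p - ∑ p ∈ P₀, μ p| ≤ ε) :
    ∃ l, SetFnIntegrableOn 𝒜 μ S l := by
  let L : Set ℝ := {x | ∃ P₀, IsFinsetPart 𝒜 S P₀ ∧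
    ∀ P, IsFinsetPart 𝒜 S P → FinsetRefines P P₀ → x ≤ ∑ p ∈ P, μ p}
  refine ⟨sSup L, setFnIntegrableOn_iff_finset.2 fun ε hε => ?_⟩
  obtain ⟨P₀, hP₀, hclose⟩ := h (ε / 2) (half_pos hε)
  have hle : ∀ x ∈ L, x ≤ ∑ p ∈ P₀, μ p + ε / 2 := by
    rintro x ⟨P₁, hP₁, hx⟩
    obtain ⟨R, hR, hR₀, hR₁⟩ := hP₀.exists_refines hinter hP₁ subset_rfl
    linarith [hx R hR hR₁, (abs_le.1 (hclose R hR hR₀)).2]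
  have hmem : ∑ p ∈ P₀, μ p - ε / 2 ∈ L :=
    ⟨P₀, hP₀, fun P hP href => by linarith [(abs_le.1 (hclose P hP href)).1]⟩
  refine ⟨P₀, hP₀, fun P hP href => ?_⟩
  have h₁ : sSup L ≤ ∑ p ∈ P₀, μ p + ε / 2 := csSup_le ⟨_, hmem⟩ hle
  have h₂ : ∑ p ∈ P₀, μ p - ε / 2 ≤ sSup L := le_csSup ⟨_, hle⟩ hmem
  have h₃ := abs_le.1 (hclose P hP href)
  rw [abs_le]
  constructor <;> linarith [h₃.1, h₃.2]

/-- Integrability passes to any `A ∈ 𝒜` that has a complement in `S` belonging to `𝒜`. -/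
theorem SetFnIntegrableOn.exists_of_union {l : ℝ} (hinter : ∀ A ∈ 𝒜, ∀ B ∈ 𝒜, A ∩ B ∈ 𝒜)
    (hint : SetFnIntegrableOn 𝒜 μ (A ∪ B) l) (hA : A ∈ 𝒜) (hB : B ∈ 𝒜) (hAB : Disjoint A B) :
    ∃ l', SetFnIntegrableOn 𝒜 μ A l' := by
  classical
  rw [setFnIntegrableOn_iff_finset] at hint
  refine exists_setFnIntegrableOn_of_cauchy hinter fun ε hε => ?_
  obtain ⟨P₀, hP₀, h⟩ := hint (ε / 2) (half_pos hε)
  obtain ⟨Q, hQ, hQP⟩ := hP₀.exists_restrict hinter hA Set.subset_union_left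
  obtain ⟨R, hR, hRP⟩ := hP₀.exists_restrict hinter hB Set.subset_union_right
  refine ⟨Q, hQ, fun P hP hPQ => ?_⟩
  have h₁ := h _ (hP.union hR hAB) ((hPQ.trans hQP).union_left hRP)
  have h₂ := h _ (hQ.union hR hAB) (hQP.union_left hRP)
  rw [hP.sum_union hR hAB, abs_le] at h₁
  rw [hQ.sum_union hR hAB, abs_le] at h₂
  rw [abs_le]
  constructor <;> linarith [h₁.1, h₁.2, h₂.1, h₂.2]

theorem SetFnIntegrableOn.eq_add {a b c : ℝ} (hinter : ∀ A ∈ 𝒜, ∀ B ∈ 𝒜, A ∩ B ∈ 𝒜)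
    (hAB : Disjoint A B) (hc : SetFnIntegrableOn 𝒜 μ (A ∪ B) c)
    (ha : SetFnIntegrableOn 𝒜 μ A a) (hb : SetFnIntegrableOn 𝒜 μ B b) : c = a + b := by
  classical
  rw [setFnIntegrableOn_iff_finset] at ha hb hc
  refine eq_of_forall_dist_le fun ε hε => ?_
  obtain ⟨PA, hPA, ha⟩ := ha (ε / 3) (by positivity)
  obtain ⟨PB, hPB, hb⟩ := hb (ε / 3) (by positivity)
  obtain ⟨PC, hPC, hc⟩ := hc (ε / 3) (by positivity)
  obtain ⟨QA, hQA, hQAC, hQAA⟩ := hPC.exists_refines hinter hPA Set.subset_union_left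
  obtain ⟨QB, hQB, hQBC, hQBB⟩ := hPC.exists_refines hinter hPB Set.subset_union_right
  have h₁ := abs_le.1 (ha QA hQA hQAA)
  have h₂ := abs_le.1 (hb QB hQB hQBB)
  have h₃ := hc _ (hQA.union hQB hAB) (hQAC.union_left hQBC)
  rw [hQA.sum_union hQB hAB, abs_le] at h₃
  rw [Real.dist_eq, abs_le]
  constructor <;> linarith [h₁.1, h₁.2, h₂.1, h₂.2, h₃.1, h₃.2]

end

/-- If `μ` is integrable then all its restrictions `μ_A`, `A ∈ 𝒜`, are integrable,
and the resulting integral function `Ψ(A) = ∫_A μ` is finitely additive on `𝒜`. -/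
theorem restriction_integrable_and_integral_additive
    {T : Type*} [Nonempty T] (𝒜 : Set (Set T)) (μ : Set T → ℝ)
    (h𝒜empty : ∅ ∈ 𝒜) (h𝒜univ : Set.univ ∈ 𝒜)
    (h𝒜compl : ∀ A ∈ 𝒜, Aᶜ ∈ 𝒜) (h𝒜union : ∀ A ∈ 𝒜, ∀ B ∈ 𝒜, A ∪ B ∈ 𝒜)
    (hμ0 : μ ∅ = 0) (hμnn : ∀ A ∈ 𝒜, 0 ≤ μ A)
    (hint : ∃ l : ℝ, SetFnIntegrableOn 𝒜 μ Set.univ l) :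
    ∃ Ψ : Set T → ℝ, (∀ A ∈ 𝒜, SetFnIntegrableOn 𝒜 μ A (Ψ A)) ∧
      (∀ A ∈ 𝒜, ∀ B ∈ 𝒜, Disjoint A B → Ψ (A ∪ B) = Ψ A + Ψ B) := by
  have hinter : ∀ A ∈ 𝒜, ∀ B ∈ 𝒜, A ∩ B ∈ 𝒜 := fun A hA B hB => by
    have := h𝒜compl _ (h𝒜union _ (h𝒜compl A hA) _ (h𝒜compl B hB))
    rwa [Set.compl_union, compl_compl, compl_compl] at this
  obtain ⟨l, hl⟩ := hint
  have hex : ∀ A, ∃ l', A ∈ 𝒜 → SetFnIntegrableOn 𝒜 μ A l' := fun A => by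
    by_cases hA : A ∈ 𝒜
    · rw [← Set.union_compl_self A] at hl
      obtain ⟨l', hl'⟩ := hl.exists_of_union hinter hA (h𝒜compl A hA) disjoint_compl_right
      exact ⟨l', fun _ => hl'⟩
    · exact ⟨0, fun h => absurd h hA⟩
  choose Ψ hΨ using hex
  exact ⟨Ψ, hΨ, fun A hA B hB hAB => SetFnIntegrableOn.eq_add hinter hAB
    (hΨ _ (h𝒜union A hA B hB)) (hΨ A hA) (hΨ B hB)⟩
end

section
/- Let μ : 𝒜 → [0,∞) be a non-negative, integrable, increasing set function with μ(∅) = 0 on an algebra 𝒜 of subsets of T, with integral function Ψ. Fix ε > 0 and let P_ε = {E_1,…,E_n} be an ε-approximated partition for μ in T, i.e. |Ψ(T) − Σ_{i=1}^K μ(C_i)| ≤ ε for every finite partition {C_1,…,C_K} of T finer than P_ε. Then for every A ∈ 𝒜, the family {E_1∩A,…,E_n∩A} (discarding empty intersections) is a 2ε-approximated partition for μ_A in A: |Ψ(A) − Σ_{j=1}^K μ(D_j)| ≤ 2ε for every finite partition {D_1,…,D_K} of A by sets of 𝒜 finer than {E_1∩A,…,E_n∩A}. -/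
/-- The empty members of a finite disjoint family can be discarded without changing the sum of a
set function vanishing at `∅`. -/
theorem exists_isFinPart_of_disjoint_family {T ι : Type*} [Fintype ι] {𝒜 : Set (Set T)}
    {μ : Set T → ℝ} (hμ0 : μ ∅ = 0) {S : Set T} {C : ι → Set T} (hC : ∀ i, C i ∈ 𝒜)
    (hdisj : Pairwise fun i j => Disjoint (C i) (C j)) (hS : (⋃ i, C i) = S) :
    ∃ (K : ℕ) (P : Fin K → Set T), IsFinPart 𝒜 S P ∧ (∀ j, ∃ i, P j = C i) ∧
      ∑ j, μ (P j) = ∑ i, μ (C i) := by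
  classical
  let e := Fintype.equivFin {i // (C i).Nonempty}
  refine ⟨_, fun j => C (e.symm j), ⟨fun j => hC _, fun j => (e.symm j).2, ?_, ?_⟩,
    fun j => ⟨_, rfl⟩, ?_⟩
  · intro i j hij
    exact hdisj fun h => hij (e.symm.injective (Subtype.ext h))
  · rw [← hS]
    ext x
    simp only [Set.mem_iUnion]
    constructor
    · rintro ⟨j, hj⟩
      exact ⟨_, hj⟩
    · rintro ⟨i, hi⟩
      exact ⟨e ⟨i, x, hi⟩, by simpa using hi⟩
  · rw [e.symm.sum_comp fun i => μ (C i),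
      ← Finset.sum_subtype (Finset.univ.filter fun i => (C i).Nonempty) (by simp)
        fun i => μ (C i)]
    refine Finset.sum_subset (Finset.subset_univ _) fun i _ hi => ?_
    have hempty : C i = ∅ := by simpa [Set.not_nonempty_iff_eq_empty] using hi
    rw [hempty, hμ0]

/-- Two finite partitions by members of an intersection-closed family have a common refinement. -/
theorem IsFinPart.exists_common_refinement {T : Type*} {𝒜 : Set (Set T)}
    (hinter : ∀ A ∈ 𝒜, ∀ B ∈ 𝒜, A ∩ B ∈ 𝒜) {S : Set T} {m n : ℕ}
    {P : Fin m → Set T} {Q : Fin n → Set T} (hP : IsFinPart 𝒜 S P) (hQ : IsFinPart 𝒜 S Q) :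
    ∃ (K : ℕ) (R : Fin K → Set T), IsFinPart 𝒜 S R ∧ (∀ j, ∃ i, R j ⊆ P i) ∧
      ∀ j, ∃ i, R j ⊆ Q i := by
  obtain ⟨hPmem, -, hPdisj, hPunion⟩ := hP
  obtain ⟨hQmem, -, hQdisj, hQunion⟩ := hQ
  obtain ⟨K, R, hR, hRsub, -⟩ := exists_isFinPart_of_disjoint_family (𝒜 := 𝒜) (μ := 0) rfl
    (S := S) (C := fun p : Fin m × Fin n => P p.1 ∩ Q p.2)
    (fun p => hinter _ (hPmem _) _ (hQmem _)) (by
      rintro ⟨i, j⟩ ⟨i', j'⟩ hne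
      by_cases hi : i = i'
      · have hj : j ≠ j' := fun hj => hne (by rw [hi, hj])
        exact (hQdisj hj).mono Set.inter_subset_right Set.inter_subset_right
      · exact (hPdisj hi).mono Set.inter_subset_left Set.inter_subset_left)
    (by rw [Set.iUnion_prod', ← Set.iUnion_inter_iUnion, hPunion, hQunion, Set.inter_self])
  refine ⟨K, R, hR, fun j => ?_, fun j => ?_⟩
  · obtain ⟨p, hp⟩ := hRsub j
    exact ⟨p.1, hp ▸ Set.inter_subset_left⟩
  · obtain ⟨p, hp⟩ := hRsub j
    exact ⟨p.2, hp ▸ Set.inter_subset_right⟩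

/-- A partition of `A` refining a partition `E` of the whole space extends, by the traces of `E`
outside `A`, to a partition of the whole space refining `E`. -/
theorem IsFinPart.exists_extension {T : Type*} {𝒜 : Set (Set T)} {μ : Set T → ℝ}
    (hμ0 : μ ∅ = 0) (hdiff : ∀ A ∈ 𝒜, ∀ B ∈ 𝒜, A \ B ∈ 𝒜) {A : Set T} (hA : A ∈ 𝒜)
    {n K : ℕ} {E : Fin n → Set T} {D : Fin K → Set T} (hE : IsFinPart 𝒜 Set.univ E)
    (hD : IsFinPart 𝒜 A D) (hDE : ∀ j, ∃ i, D j ⊆ E i) :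
    ∃ (N : ℕ) (C : Fin N → Set T), IsFinPart 𝒜 Set.univ C ∧ (∀ j, ∃ i, C j ⊆ E i) ∧
      ∑ j, μ (C j) = ∑ j, μ (D j) + ∑ i, μ (E i \ A) := by
  obtain ⟨hEmem, -, hEdisj, hEunion⟩ := hE
  obtain ⟨hDmem, -, hDdisj, hDunion⟩ := hD
  have hDA : ∀ j, D j ⊆ A := fun j => hDunion ▸ Set.subset_iUnion D j
  obtain ⟨N, C, hC, hCsub, hsum⟩ := exists_isFinPart_of_disjoint_family (𝒜 := 𝒜) hμ0
    (S := Set.univ) (C := Sum.elim D fun i => E i \ A)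
    (by
      rintro (j | i)
      · exact hDmem j
      · exact hdiff _ (hEmem i) _ hA)
    (by
      rintro (j | i) (j' | i') hne
      · exact hDdisj fun h => hne (by rw [h])
      · exact Set.disjoint_sdiff_right.mono_left (hDA j)
      · exact Set.disjoint_sdiff_left.mono_right (hDA j')
      · exact (hEdisj fun h => hne (by rw [h])).mono Set.sdiff_subset Set.sdiff_subset)
    (by
      simp only [Set.iUnion_sum, Sum.elim_inl, Sum.elim_inr]
      rw [hDunion, ← Set.iUnion_sdiff, hEunion, Set.union_sdiff_self, Set.union_univ])
  refine ⟨N, C, hC, fun j => ?_, by simpa [Fintype.sum_sum_type] using hsum⟩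
  obtain ⟨k | i, hk⟩ := hCsub j
  · obtain ⟨i, hi⟩ := hDE k
    exact ⟨i, hk ▸ hi⟩
  · exact ⟨i, hk ▸ Set.sdiff_subset⟩

/-- If `{E_1,…,E_n}` is an `ε`-approximated partition for `μ` in `T`, then for every `A ∈ 𝒜`
the trace family `{E_i ∩ A}` is a `2ε`-approximated partition for the restriction `μ_A`. -/
theorem trace_of_approximated_partition
    {T : Type*} [Nonempty T] (𝒜 : Set (Set T)) (μ : Set T → ℝ)
    (h𝒜empty : ∅ ∈ 𝒜) (h𝒜univ : Set.univ ∈ 𝒜)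
    (h𝒜compl : ∀ A ∈ 𝒜, Aᶜ ∈ 𝒜) (h𝒜union : ∀ A ∈ 𝒜, ∀ B ∈ 𝒜, A ∪ B ∈ 𝒜)
    (hμ0 : μ ∅ = 0) (hμnn : ∀ A ∈ 𝒜, 0 ≤ μ A)
    (hμmono : ∀ A ∈ 𝒜, ∀ B ∈ 𝒜, A ⊆ B → μ A ≤ μ B)
    (Ψ : Set T → ℝ) (hΨ : ∀ A ∈ 𝒜, SetFnIntegrableOn 𝒜 μ A (Ψ A))
    (ε : ℝ) (hε : 0 < ε)
    (n : ℕ) (E : Fin n → Set T) (hE : IsFinPart 𝒜 Set.univ E)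
    (happrox : ∀ (K : ℕ) (C : Fin K → Set T), IsFinPart 𝒜 Set.univ C →
      (∀ j, ∃ i, C j ⊆ E i) → |Ψ Set.univ - ∑ j, μ (C j)| ≤ ε) :
    ∀ A ∈ 𝒜, ∀ (K : ℕ) (D : Fin K → Set T), IsFinPart 𝒜 A D →
      (∀ j, ∃ i, D j ⊆ E i ∩ A) → |Ψ A - ∑ j, μ (D j)| ≤ 2 * ε := by
  have hinter : ∀ A ∈ 𝒜, ∀ B ∈ 𝒜, A ∩ B ∈ 𝒜 := fun A hA B hB => by
    rw [Set.inter_eq_compl_compl_union_compl]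
    exact h𝒜compl _ (h𝒜union _ (h𝒜compl _ hA) _ (h𝒜compl _ hB))
  have hdiff : ∀ A ∈ 𝒜, ∀ B ∈ 𝒜, A \ B ∈ 𝒜 := fun A hA B hB =>
    hinter _ hA _ (h𝒜compl _ hB)
  intro A hA K D hD hDE
  have hDE' : ∀ j, ∃ i, D j ⊆ E i := fun j =>
    (hDE j).imp fun _ h => h.trans Set.inter_subset_left
  refine le_of_forall_pos_le_add fun η hη => ?_
  obtain ⟨m, P, hP, hPη⟩ := hΨ A hA η hη
  obtain ⟨L, G, hG, hGD, hGP⟩ := hD.exists_common_refinement hinter hP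
  have hGE : ∀ j, ∃ i, G j ⊆ E i := fun j => by
    obtain ⟨k, hk⟩ := hGD j
    exact (hDE' k).imp fun _ h => hk.trans h
  obtain ⟨M, C, hC, hCE, hCsum⟩ := hE.exists_extension hμ0 hdiff hA hD hDE'
  obtain ⟨N, C', hC', hCE', hCsum'⟩ := hE.exists_extension hμ0 hdiff hA hG hGE
  have hDε := abs_le.mp (happrox M C hC hCE)
  have hGε := abs_le.mp (happrox N C' hC' hCE')
  have hGη := abs_le.mp (hPη L G hG hGP)
  rw [hCsum] at hDε
  rw [hCsum'] at hGε
  rw [abs_le]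
  constructor <;> linarith [hDε.1, hDε.2, hGε.1, hGε.2, hGη.1, hGη.2]
end

section
/- Let μ : 𝒜 → [0,∞) be a non-negative, integrable, increasing set function with μ(∅) = 0 on an algebra 𝒜 of subsets of T, with integral function Ψ. Then a Henstock-type lemma holds: for every ε > 0 there exists a finite partition P_ε of T such that, for every finite partition {C_1,…,C_K} of T finer than P_ε and every set A ∈ 𝒜, one has Σ_{i=1}^K |Ψ(C_i ∩ A) − μ(C_i ∩ A)| ≤ ε. -/
/-- `s` is the sum of `μ` over a finite disjoint decomposition of `S` into (possibly empty)
members of `𝒜`. -/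
def IsDecompSum {T : Type*} (𝒜 : Set (Set T)) (μ : Set T → ℝ) (S : Set T) (s : ℝ) : Prop :=
  ∃ (m : ℕ) (R : Fin m → Set T), (∀ k, R k ∈ 𝒜) ∧
    (Pairwise fun i j => Disjoint (R i) (R j)) ∧ (⋃ k, R k) = S ∧ ∑ k, μ (R k) = s

lemma isDecompSum_self {T : Type*} {𝒜 : Set (Set T)} {S : Set T} (μ : Set T → ℝ) (hS : S ∈ 𝒜) :
    IsDecompSum 𝒜 μ S (μ S) :=
  ⟨1, fun _ => S, fun _ => hS, fun i j hij => (hij (Subsingleton.elim i j)).elim,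
    Set.iUnion_const S, by simp⟩

lemma SetFnIntegrableOn.exists_isDecompSum {T : Type*} {𝒜 : Set (Set T)} {μ : Set T → ℝ}
    {S : Set T} {l : ℝ} (h : SetFnIntegrableOn 𝒜 μ S l) {ε : ℝ} (hε : 0 < ε) :
    ∃ s, IsDecompSum 𝒜 μ S s ∧ |s - l| ≤ ε := by
  obtain ⟨n, Q, hQ, h⟩ := h ε hε
  exact ⟨_, ⟨n, Q, hQ.1, hQ.2.2.1, hQ.2.2.2, rfl⟩, h n Q hQ fun j => ⟨j, subset_rfl⟩⟩

/-- Discarding the empty members of a finite disjoint decomposition gives a partition with the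
same sum. -/
lemma exists_isFinPart_sum_eq {T ι : Type*} [Fintype ι] {𝒜 : Set (Set T)} {μ : Set T → ℝ}
    {S : Set T} (hμ0 : μ ∅ = 0) (B : ι → Set T) (hB : ∀ i, B i ∈ 𝒜)
    (hdisj : Pairwise fun i j => Disjoint (B i) (B j)) (hU : (⋃ i, B i) = S) :
    ∃ (m : ℕ) (P : Fin m → Set T), IsFinPart 𝒜 S P ∧ (∀ j, ∃ i, P j = B i) ∧
      ∑ j, μ (P j) = ∑ i, μ (B i) := by
  classical
  let e := Fintype.equivFin {i // (B i).Nonempty}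
  refine ⟨_, fun j => B (e.symm j), ⟨fun j => hB _, fun j => (e.symm j).2, ?_, ?_⟩,
    fun j => ⟨_, rfl⟩, ?_⟩
  · intro i j hij
    exact hdisj fun h => hij (e.symm.injective (Subtype.ext h))
  · rw [← hU]
    ext x
    simp only [Set.mem_iUnion]
    refine ⟨fun ⟨j, hj⟩ => ⟨_, hj⟩, fun ⟨i, hi⟩ => ⟨e ⟨i, x, hi⟩, by simpa using hi⟩⟩
  · rw [e.symm.sum_comp fun i : {i // (B i).Nonempty} => μ (B i),
      ← Finset.sum_subtype (Finset.univ.filter fun i => (B i).Nonempty) (by simp)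
        fun i => μ (B i)]
    refine Finset.sum_filter_of_ne fun i _ hi => Set.nonempty_iff_ne_empty.2 fun h => hi ?_
    rw [h, hμ0]

/-- Decomposing each `C j ∩ A` arbitrarily and keeping each `C j \ A` whole yields a partition
refining `C`. -/
lemma exists_isFinPart_refining {T : Type*} {𝒜 : Set (Set T)} {μ : Set T → ℝ} {S A : Set T}
    (hμ0 : μ ∅ = 0) {K : ℕ} {C : Fin K → Set T} (hC : IsFinPart 𝒜 S C)
    (hdiff : ∀ j, C j \ A ∈ 𝒜) {s : Fin K → ℝ} (hs : ∀ j, IsDecompSum 𝒜 μ (C j ∩ A) (s j)) :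
    ∃ (m : ℕ) (P : Fin m → Set T), IsFinPart 𝒜 S P ∧ (∀ i, ∃ j, P i ⊆ C j) ∧
      ∑ i, μ (P i) = ∑ j, (μ (C j \ A) + s j) := by
  choose m R hR hdisj hU hsum using hs
  have hRsub (j k) : R j k ⊆ C j ∩ A := hU j ▸ Set.subset_iUnion (R j) k
  let B : (Σ j, Option (Fin (m j))) → Set T := fun p => p.2.elim (C p.1 \ A) (R p.1)
  have hBsub : ∀ p, B p ⊆ C p.1 := by
    rintro ⟨j, _ | k⟩
    · exact Set.sdiff_subset
    · exact (hRsub j k).trans Set.inter_subset_left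
  have hBdisj : Pairwise fun p q => Disjoint (B p) (B q) := by
    rintro ⟨i, a⟩ ⟨j, b⟩ hne
    by_cases hij : i = j
    · subst hij
      have hab : a ≠ b := fun h => hne (h ▸ rfl)
      have hsplit : Disjoint (C i \ A) (C i ∩ A) :=
        Set.disjoint_sdiff_left.mono_right Set.inter_subset_right
      cases a <;> cases b
      · exact (hab rfl).elim
      · exact hsplit.mono_right (hRsub _ _)
      · exact (hsplit.mono_right (hRsub _ _)).symm
      · exact hdisj i fun h => hab (congrArg some h)
    · exact (hC.2.2.1 hij).mono (hBsub _) (hBsub _)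
  have hBU : (⋃ p, B p) = S := by
    rw [← hC.2.2.2, Set.iUnion_sigma]
    refine Set.iUnion_congr fun j => ?_
    rw [Set.iUnion_option]
    change C j \ A ∪ ⋃ k, R j k = C j
    rw [hU, Set.sdiff_union_inter]
  obtain ⟨M, P, hP, hPB, hPsum⟩ := exists_isFinPart_sum_eq (𝒜 := 𝒜) hμ0 B
    (by rintro ⟨j, _ | k⟩; exacts [hdiff j, hR j k]) hBdisj hBU
  refine ⟨M, P, hP, fun i => ?_, ?_⟩
  · obtain ⟨p, hp⟩ := hPB i
    exact ⟨p.1, hp ▸ hBsub p⟩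
  · simp [hPsum, Fintype.sum_sigma, Fintype.sum_option, B, hsum]

/-- Henstock-type lemma for the integral function `Ψ` of an integrable, increasing
set function `μ`. -/
theorem henstock_lemma_for_integral_function
    {T : Type*} [Nonempty T] (𝒜 : Set (Set T)) (μ : Set T → ℝ)
    (h𝒜empty : ∅ ∈ 𝒜) (h𝒜univ : Set.univ ∈ 𝒜)
    (h𝒜compl : ∀ A ∈ 𝒜, Aᶜ ∈ 𝒜) (h𝒜union : ∀ A ∈ 𝒜, ∀ B ∈ 𝒜, A ∪ B ∈ 𝒜)
    (h𝒜inter : ∀ A ∈ 𝒜, ∀ B ∈ 𝒜, A ∩ B ∈ 𝒜)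
    (hμ0 : μ ∅ = 0) (hμnn : ∀ A ∈ 𝒜, 0 ≤ μ A)
    (hμmono : ∀ A ∈ 𝒜, ∀ B ∈ 𝒜, A ⊆ B → μ A ≤ μ B)
    (Ψ : Set T → ℝ) (hΨ : ∀ A ∈ 𝒜, SetFnIntegrableOn 𝒜 μ A (Ψ A)) :
    ∀ ε > (0 : ℝ), ∃ (n : ℕ) (P₀ : Fin n → Set T), IsFinPart 𝒜 Set.univ P₀ ∧
      ∀ (K : ℕ) (C : Fin K → Set T), IsFinPart 𝒜 Set.univ C → (∀ j, ∃ i, C j ⊆ P₀ i) →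
        ∀ A ∈ 𝒜, (∑ j, |Ψ (C j ∩ A) - μ (C j ∩ A)|) ≤ ε := by
  intro ε hε
  obtain ⟨n, P₀, hP₀, hint⟩ := hΨ Set.univ h𝒜univ (ε / 4) (by positivity)
  refine ⟨n, P₀, hP₀, fun K C hC hCP A hA => ?_⟩
  have hCA (j) : C j ∩ A ∈ 𝒜 := h𝒜inter _ (hC.1 j) _ hA
  have hdiff (j) : C j \ A ∈ 𝒜 := h𝒜inter _ (hC.1 j) _ (h𝒜compl _ hA)
  have hsums {s : Fin K → ℝ} (hs : ∀ j, IsDecompSum 𝒜 μ (C j ∩ A) (s j)) :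
      |∑ j, (μ (C j \ A) + s j) - Ψ Set.univ| ≤ ε / 4 := by
    obtain ⟨m, P, hP, hPC, hPsum⟩ := exists_isFinPart_refining hμ0 hC hdiff hs
    rw [← hPsum]
    refine hint m P hP fun i => ?_
    obtain ⟨j, hj⟩ := hPC i
    obtain ⟨k, hk⟩ := hCP j
    exact ⟨k, hj.trans hk⟩
  have hη : 0 < ε / (2 * (K + 1)) := by positivity
  choose v hv hvΨ using fun j => (hΨ _ (hCA j)).exists_isDecompSum hη
  have hmax := hsums (s := fun j => max (v j) (μ (C j ∩ A))) fun j => by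
    rcases max_choice (v j) (μ (C j ∩ A)) with h | h <;> rw [h]
    exacts [hv j, isDecompSum_self μ (hCA j)]
  have hmin := hsums (s := fun j => min (v j) (μ (C j ∩ A))) fun j => by
    rcases min_choice (v j) (μ (C j ∩ A)) with h | h <;> rw [h]
    exacts [hv j, isDecompSum_self μ (hCA j)]
  have hvμ : ∑ j, |v j - μ (C j ∩ A)| ≤ ε / 2 := by
    have heq : ∑ j, |v j - μ (C j ∩ A)| =
        ∑ j, (μ (C j \ A) + max (v j) (μ (C j ∩ A))) -
          ∑ j, (μ (C j \ A) + min (v j) (μ (C j ∩ A))) := by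
      rw [← Finset.sum_sub_distrib]
      exact Finset.sum_congr rfl fun j _ => by rw [add_sub_add_left_eq_sub, max_sub_min_eq_abs']
    linarith [(abs_le.1 hmax).2, (abs_le.1 hmin).1]
  have hΨv : ∑ j, |v j - Ψ (C j ∩ A)| ≤ ε / 2 := by
    calc ∑ j, |v j - Ψ (C j ∩ A)| ≤ ∑ _j : Fin K, ε / (2 * (K + 1)) :=
          Finset.sum_le_sum fun j _ => hvΨ j
      _ = K * (ε / (2 * (K + 1))) := by simp
      _ ≤ (K + 1) * (ε / (2 * (K + 1))) := by gcongr; linarith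
      _ = ε / 2 := by field_simp
  calc ∑ j, |Ψ (C j ∩ A) - μ (C j ∩ A)|
      ≤ ∑ j, (|v j - Ψ (C j ∩ A)| + |v j - μ (C j ∩ A)|) :=
        Finset.sum_le_sum fun j _ => by
          rw [abs_sub_comm (v j) (Ψ _)]
          exact abs_sub_le _ _ _
    _ ≤ ε := by rw [Finset.sum_add_distrib]; linarith
end

section
/- Let 𝒜 be a σ-algebra of subsets of T and μ : 𝒜 → [0,∞) an increasing set function with μ(∅) = 0 which is continuous from below (i.e. lim_n μ(A_n) = μ(⋃_n A_n) for every increasing sequence (A_n) in 𝒜). If μ is integrable, then the mapping A ↦ Ψ(A) = ∫_A μ is countably additive on 𝒜. -/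
open MeasureTheory Filter Topology

namespace SetFnIntegral

variable {T : Type*} {𝒜 : Set (Set T)} {μ : Set T → ℝ}

/-- A family of pairwise disjoint, possibly empty, members of `𝒜` with union `S`. -/
structure IsPart (𝒜 : Set (Set T)) (S : Set T) {ι : Type} (P : ι → Set T) : Prop where
  mem : ∀ i, P i ∈ 𝒜
  disjoint : Pairwise fun i j => Disjoint (P i) (P j)
  iUnion_eq : ⋃ i, P i = S

/-- Every nonempty member of `P` is contained in a member of `Q`. -/
def Refines {ι κ : Type} (P : ι → Set T) (Q : κ → Set T) : Prop :=
  ∀ i, (P i).Nonempty → ∃ k, P i ⊆ Q k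

/-- All sums of `μ` over partitions of `S` finer than `P₀` are within `ε` of `l`. -/
def Approximates (𝒜 : Set (Set T)) (μ : Set T → ℝ) (S : Set T) (l ε : ℝ) {n : ℕ}
    (P₀ : Fin n → Set T) : Prop :=
  ∀ {ι : Type} [Fintype ι] (P : ι → Set T), IsPart 𝒜 S P → Refines P P₀ →
    |∑ i, μ (P i) - l| ≤ ε

theorem Refines.refl {ι : Type} (P : ι → Set T) : Refines P P :=
  fun i _ => ⟨i, subset_rfl⟩

theorem refines_inter_left {ι κ : Type} (P : ι → Set T) (Q : κ → Set T) :
    Refines (fun x : ι × κ => P x.1 ∩ Q x.2) P :=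
  fun x _ => ⟨x.1, Set.inter_subset_left⟩

theorem refines_inter_right {ι κ : Type} (P : ι → Set T) (Q : κ → Set T) :
    Refines (fun x : ι × κ => P x.1 ∩ Q x.2) Q :=
  fun x _ => ⟨x.2, Set.inter_subset_right⟩

theorem refines_inter_const {ι : Type} (P : ι → Set T) (E : Set T) :
    Refines (fun i => P i ∩ E) P :=
  fun i _ => ⟨i, Set.inter_subset_left⟩

theorem Refines.sumElim {ι κ η : Type} {P : ι → Set T} {Q : κ → Set T} {R : η → Set T}
    (hP : Refines P R) (hQ : Refines Q R) : Refines (Sum.elim P Q) R := by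
  rintro (i | j) h
  · exact hP i h
  · exact hQ j h

theorem IsPart.inter {ι κ : Type} {S S' : Set T} {P : ι → Set T} {Q : κ → Set T}
    (h𝒜 : IsSetRing 𝒜) (hP : IsPart 𝒜 S P) (hQ : IsPart 𝒜 S' Q) :
    IsPart 𝒜 (S ∩ S') (fun x : ι × κ => P x.1 ∩ Q x.2) where
  mem x := h𝒜.inter_mem (hP.mem _) (hQ.mem _)
  disjoint := by
    rintro ⟨i, j⟩ ⟨i', j'⟩ hne
    by_cases hi : i = i'
    · have hj : j ≠ j' := by rintro rfl; exact hne (by rw [hi])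
      exact (hQ.disjoint hj).mono Set.inter_subset_right Set.inter_subset_right
    · exact (hP.disjoint hi).mono Set.inter_subset_left Set.inter_subset_left
  iUnion_eq := by
    rw [← hP.iUnion_eq, ← hQ.iUnion_eq]
    ext x
    simp

theorem IsPart.inter_const {ι : Type} {S E : Set T} {P : ι → Set T}
    (h𝒜 : IsSetRing 𝒜) (hP : IsPart 𝒜 S P) (hE : E ∈ 𝒜) (hES : E ⊆ S) :
    IsPart 𝒜 E (fun i => P i ∩ E) where
  mem i := h𝒜.inter_mem (hP.mem i) hE
  disjoint _ _ hij := (hP.disjoint hij).mono Set.inter_subset_left Set.inter_subset_left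
  iUnion_eq := by rw [← Set.iUnion_inter, hP.iUnion_eq, Set.inter_eq_right.2 hES]

theorem IsPart.sumElim {ι κ : Type} {S S' : Set T} {P : ι → Set T} {Q : κ → Set T}
    (hP : IsPart 𝒜 S P) (hQ : IsPart 𝒜 S' Q) (hd : Disjoint S S') :
    IsPart 𝒜 (S ∪ S') (Sum.elim P Q) where
  mem := by
    rintro (i | j)
    · exact hP.mem i
    · exact hQ.mem j
  disjoint := by
    have hPQ : ∀ i j, Disjoint (P i) (Q j) := fun i j =>
      hd.mono (hP.iUnion_eq ▸ Set.subset_iUnion P i) (hQ.iUnion_eq ▸ Set.subset_iUnion Q j)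
    rintro (i | i) (j | j) hij
    · exact hP.disjoint fun h => hij (by rw [h])
    · exact hPQ i j
    · exact (hPQ j i).symm
    · exact hQ.disjoint fun h => hij (by rw [h])
  iUnion_eq := by
    rw [Set.iUnion_sum, ← hP.iUnion_eq, ← hQ.iUnion_eq]
    rfl

theorem exists_approximates {S : Set T} {l ε : ℝ} (hμ0 : μ ∅ = 0)
    (h : SetFnIntegrableOn 𝒜 μ S l) (hε : 0 < ε) :
    ∃ (n : ℕ) (P₀ : Fin n → Set T), IsPart 𝒜 S P₀ ∧ Approximates 𝒜 μ S l ε P₀ := by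
  classical
  obtain ⟨n, P₀, ⟨hmem, -, hdisj, hU⟩, hP₀⟩ := h ε hε
  refine ⟨n, P₀, ⟨hmem, hdisj, hU⟩, fun {ι} _ P hP hPr => ?_⟩
  let e := Fintype.equivFin {i // (P i).Nonempty}
  have key := hP₀ _ (fun k => P (e.symm k)) ⟨fun k => hP.mem _, fun k => (e.symm k).2,
    fun k k' hk => hP.disjoint fun h => hk (e.symm.injective (Subtype.ext h)), ?_⟩
    fun k => hPr _ (e.symm k).2
  · rw [e.symm.sum_comp (fun i : {i // (P i).Nonempty} => μ (P i)),
      ← Finset.sum_subtype (Finset.univ.filter fun i => (P i).Nonempty) (by simp)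
        (fun i => μ (P i)), Finset.sum_filter_of_ne] at key
    · exact key
    · intro i _ hi
      by_contra hne
      exact hi (by rw [Set.not_nonempty_iff_eq_empty.1 hne, hμ0])
  · rw [← hP.iUnion_eq, e.symm.surjective.iUnion_comp
      (fun i : {i // (P i).Nonempty} => P i)]
    ext x
    simp only [Set.mem_iUnion, Subtype.exists, exists_prop]
    exact ⟨fun ⟨i, _, hx⟩ => ⟨i, hx⟩, fun ⟨i, hx⟩ => ⟨i, ⟨x, hx⟩, hx⟩⟩

theorem nonneg_of_integrableOn {S : Set T} {l : ℝ} (hμ0 : μ ∅ = 0)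
    (hμnn : ∀ A ∈ 𝒜, 0 ≤ μ A) (h : SetFnIntegrableOn 𝒜 μ S l) : 0 ≤ l := by
  refine le_of_forall_pos_le_add fun ε hε => ?_
  obtain ⟨n, P, hP, hPa⟩ := exists_approximates hμ0 h hε
  have h1 := abs_le.1 (hPa P hP (Refines.refl P))
  have h2 : 0 ≤ ∑ i, μ (P i) := Finset.sum_nonneg fun i _ => hμnn _ (hP.mem i)
  linarith

theorem eq_zero_of_integrableOn_empty {l : ℝ} (hμ0 : μ ∅ = 0)
    (h : SetFnIntegrableOn 𝒜 μ ∅ l) : l = 0 := by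
  refine abs_eq_zero.1 (le_antisymm (le_of_forall_pos_le_add fun ε hε => ?_) (abs_nonneg l))
  obtain ⟨n, P, hP, hPa⟩ := exists_approximates hμ0 h hε
  have h1 := hPa (fun i : Empty => i.elim) ⟨by simp, fun i => i.elim, by simp⟩ fun i => i.elim
  simpa using h1

/-- The integral is additive on disjoint sets. -/
theorem integral_union {A B : Set T} {a b c : ℝ} (h𝒜 : IsSetRing 𝒜) (hμ0 : μ ∅ = 0)
    (hd : Disjoint A B) (hA : SetFnIntegrableOn 𝒜 μ A a) (hB : SetFnIntegrableOn 𝒜 μ B b)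
    (hAB : SetFnIntegrableOn 𝒜 μ (A ∪ B) c) : c = a + b := by
  refine sub_eq_zero.1 (abs_eq_zero.1
    (le_antisymm (le_of_forall_pos_le_add fun ε hε => ?_) (abs_nonneg _)))
  have hε3 : 0 < ε / 3 := by positivity
  obtain ⟨_, PA, hPA, hPAa⟩ := exists_approximates hμ0 hA hε3
  obtain ⟨_, PB, hPB, hPBa⟩ := exists_approximates hμ0 hB hε3
  obtain ⟨_, P, hP, hPa⟩ := exists_approximates hμ0 hAB hε3
  have hQA := hPA.inter h𝒜 hP
  have hQB := hPB.inter h𝒜 hP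
  rw [Set.inter_eq_left.2 Set.subset_union_left] at hQA
  rw [Set.inter_eq_left.2 Set.subset_union_right] at hQB
  have h1 := abs_le.1 (hPAa _ hQA (refines_inter_left _ _))
  have h2 := abs_le.1 (hPBa _ hQB (refines_inter_left _ _))
  have h3 := abs_le.1 (hPa _ (hQA.sumElim hQB hd)
    ((refines_inter_right _ _).sumElim (refines_inter_right _ _)))
  simp only [Fintype.sum_sum_type, Sum.elim_inl, Sum.elim_inr] at h3
  rw [abs_le]
  constructor <;> linarith

/-- The trace on `E` of a partition that approximates the integral over `S ⊇ E` approximates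
the integral over `E`. -/
theorem sum_inter_le_integral {S E : Set T} {l e ε : ℝ} {n : ℕ} {P : Fin n → Set T}
    (h𝒜 : IsSetRing 𝒜) (hμ0 : μ ∅ = 0) (hP : IsPart 𝒜 S P) (hPa : Approximates 𝒜 μ S l ε P)
    (hS : S ∈ 𝒜) (hE : E ∈ 𝒜) (hES : E ⊆ S) (hEi : SetFnIntegrableOn 𝒜 μ E e) :
    ∑ i, μ (P i ∩ E) ≤ e + 2 * ε := by
  refine le_of_forall_pos_le_add fun δ hδ => ?_
  obtain ⟨_, PE, hPE, hPEa⟩ := exists_approximates hμ0 hEi hδ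
  have hQ := hPE.inter h𝒜 hP
  rw [Set.inter_eq_left.2 hES] at hQ
  have hR := hP.inter_const h𝒜 (h𝒜.sdiff_mem hS hE) Set.sdiff_subset
  have hF := hQ.sumElim hR disjoint_sdiff_self_right
  have hG := (hP.inter_const h𝒜 hE hES).sumElim hR disjoint_sdiff_self_right
  rw [Set.union_sdiff_cancel hES] at hF hG
  have h1 := abs_le.1 (hPEa _ hQ (refines_inter_left _ _))
  have h2 := abs_le.1 (hPa _ hF
    ((refines_inter_right _ _).sumElim (refines_inter_const _ _)))
  have h3 := abs_le.1 (hPa _ hG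
    ((refines_inter_const _ _).sumElim (refines_inter_const _ _)))
  simp only [Fintype.sum_sum_type, Sum.elim_inl, Sum.elim_inr] at h2 h3
  linarith

end SetFnIntegral

open SetFnIntegral in
/-- If `μ` is an increasing set function on a `σ`-algebra, continuous from below and
integrable, then its integral function `Ψ(A) = ∫_A μ` is countably additive. -/
theorem integral_function_countably_additive
    {T : Type*} [Nonempty T] (𝒜 : Set (Set T)) (μ : Set T → ℝ)
    (h𝒜empty : ∅ ∈ 𝒜) (h𝒜univ : Set.univ ∈ 𝒜)
    (h𝒜compl : ∀ A ∈ 𝒜, Aᶜ ∈ 𝒜)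
    (h𝒜iUnion : ∀ A : ℕ → Set T, (∀ n, A n ∈ 𝒜) → (⋃ n, A n) ∈ 𝒜)
    (hμ0 : μ ∅ = 0) (hμnn : ∀ A ∈ 𝒜, 0 ≤ μ A)
    (hμmono : ∀ A ∈ 𝒜, ∀ B ∈ 𝒜, A ⊆ B → μ A ≤ μ B)
    (hcont : ∀ A : ℕ → Set T, (∀ n, A n ∈ 𝒜) → Monotone A →
      Filter.Tendsto (fun n => μ (A n)) Filter.atTop (nhds (μ (⋃ n, A n))))
    (Ψ : Set T → ℝ) (hΨ : ∀ A ∈ 𝒜, SetFnIntegrableOn 𝒜 μ A (Ψ A)) :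
    ∀ A : ℕ → Set T, (∀ n, A n ∈ 𝒜) → (Pairwise fun i j => Disjoint (A i) (A j)) →
      HasSum (fun n => Ψ (A n)) (Ψ (⋃ n, A n)) := by
  intro A hA hd
  have hunion : ∀ B ∈ 𝒜, ∀ C ∈ 𝒜, B ∪ C ∈ 𝒜 := by
    intro B hB C hC
    have h := h𝒜iUnion (fun n => if n = 0 then B else C) fun n => by
      split_ifs <;> assumption
    convert h using 1
    ext x
    simp only [Set.mem_union, Set.mem_iUnion]
    refine ⟨?_, ?_⟩
    · rintro (hx | hx)
      · exact ⟨0, by simpa using hx⟩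
      · exact ⟨1, by simpa using hx⟩
    · rintro ⟨n, hx⟩
      split_ifs at hx
      · exact Or.inl hx
      · exact Or.inr hx
  have h𝒜 : IsSetRing 𝒜 := ⟨h𝒜empty, fun {B C} hB hC => hunion B hB C hC, fun {B C} hB hC => by
    have h := h𝒜compl _ (hunion _ (h𝒜compl B hB) C hC)
    rwa [Set.compl_union, compl_compl, ← Set.sdiff_eq] at h⟩
  set S := ⋃ n, A n
  have hS : S ∈ 𝒜 := h𝒜iUnion A hA
  let E : ℕ → Set T := fun n => ⋃ k ∈ Finset.range n, A k
  have hE : ∀ n, E n ∈ 𝒜 := fun n => h𝒜.biUnion_mem _ fun k _ => hA k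
  have hES : ∀ n, E n ⊆ S := fun n => Set.iUnion₂_subset fun k _ => Set.subset_iUnion A k
  have hEmono : Monotone E := fun m n hmn =>
    Set.biUnion_subset_biUnion_left (Finset.range_mono hmn)
  have hEU : ⋃ n, E n = S := by
    refine (Set.iUnion_subset hES).antisymm (Set.iUnion_subset fun n => ?_)
    exact (Set.subset_biUnion_of_mem (u := A) (Finset.self_mem_range_succ n)).trans
      (Set.subset_iUnion E (n + 1))
  have hnn : ∀ B ∈ 𝒜, 0 ≤ Ψ B := fun B hB => nonneg_of_integrableOn hμ0 hμnn (hΨ B hB)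
  have hadd : ∀ B ∈ 𝒜, ∀ C ∈ 𝒜, Disjoint B C → Ψ (B ∪ C) = Ψ B + Ψ C :=
    fun B hB C hC hBC =>
      integral_union h𝒜 hμ0 hBC (hΨ B hB) (hΨ C hC) (hΨ _ (hunion B hB C hC))
  have hsum : ∀ n, ∑ k ∈ Finset.range n, Ψ (A k) = Ψ (E n) := by
    intro n
    induction n with
    | zero =>
      have : E 0 = ∅ := by simp [E]
      rw [this, Finset.sum_range_zero,
        eq_zero_of_integrableOn_empty hμ0 (hΨ ∅ h𝒜empty)]
    | succ n ih =>
      have hdisj : Disjoint (E n) (A n) := by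
        refine Set.disjoint_iUnion₂_left.2 fun k hk => hd ?_
        exact (Finset.mem_range.1 hk).ne
      have hsucc : E (n + 1) = E n ∪ A n := by
        simp only [E, Finset.range_add_one, Finset.set_biUnion_insert, Set.union_comm]
      rw [Finset.sum_range_succ, ih, hsucc, hadd _ (hE n) _ (hA n) hdisj]
  rw [hasSum_iff_tendsto_nat_of_nonneg fun n => hnn _ (hA n)]
  simp only [hsum]
  refine tendsto_order.2 ⟨fun a ha => ?_, fun a ha => Eventually.of_forall fun n => ?_⟩
  · have hε : 0 < (Ψ S - a) / 4 := by linarith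
    obtain ⟨m, P, hP, hPa⟩ := exists_approximates hμ0 (hΨ S hS) hε
    have hlim : Tendsto (fun n => ∑ i, μ (P i ∩ E n)) atTop (𝓝 (∑ i, μ (P i))) := by
      refine tendsto_finsetSum _ fun i _ => ?_
      have h := hcont (fun n => P i ∩ E n) (fun n => h𝒜.inter_mem (hP.mem i) (hE n))
        fun p q hpq => Set.inter_subset_inter_right _ (hEmono hpq)
      rwa [← Set.inter_iUnion, hEU, Set.inter_eq_left.2
        (hP.iUnion_eq ▸ Set.subset_iUnion P i)] at h
    have h1 := (abs_le.1 (hPa P hP (Refines.refl P))).1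
    have hlt : a + 2 * ((Ψ S - a) / 4) < ∑ i, μ (P i) := by linarith
    filter_upwards [hlim.eventually_const_lt hlt] with n hn
    have h2 := sum_inter_le_integral h𝒜 hμ0 hP hPa hS (hE n) (hES n) (hΨ _ (hE n))
    linarith
  · have h := hadd (E n) (hE n) (S \ E n) (h𝒜.sdiff_mem hS (hE n)) disjoint_sdiff_self_right
    rw [Set.union_sdiff_cancel (hES n)] at h
    linarith [hnn _ (h𝒜.sdiff_mem hS (hE n))]
end

section
/- Let T be a nonempty set, 𝒜 an algebra of subsets of T, μ : 𝒜 → [0,∞) a set function with μ(∅) = 0, and X a Banach space. Suppose F : T → cwk(X) is a multifunction whose values are nonempty, convex and weakly compact subsets of X, and suppose F is Gould integrable with integral I ∈ bf(X). Then I is convex and weakly compact, i.e. I ∈ cwk(X). -/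
open scoped Pointwise
open Metric

/-- The multifunction `F` is Gould integrable on `S` with respect to `μ`, with integral `I`. -/
def GouldOn {T X : Type*} [NormedAddCommGroup X] [NormedSpace ℝ X]
    (𝒜 : Set (Set T)) (μ : Set T → ℝ) (S : Set T) (F : T → Set X) (I : Set X) : Prop :=
  ∀ ε > (0 : ℝ), ∃ (n : ℕ) (P₀ : Fin n → Set T), IsFinPart 𝒜 S P₀ ∧
    ∀ (m : ℕ) (P : Fin m → Set T), IsFinPart 𝒜 S P → (∀ j, ∃ i, P j ⊆ P₀ i) →
      ∀ t : Fin m → T, (∀ j, t j ∈ P j) →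
        hausdorffDist (closure (∑ j, μ (P j) • F (t j))) I < ε

open Filter Topology

/-- Convergence in the weak topology is convergence of all continuous linear functionals. -/
theorem tendsto_toWeakSpace_iff {α X : Type*} [NormedAddCommGroup X] [NormedSpace ℝ X]
    {l : Filter α} {g : α → X} {x : X} :
    Tendsto (fun a => toWeakSpace ℝ X (g a)) l (𝓝 (toWeakSpace ℝ X x)) ↔
      ∀ f : StrongDual ℝ X, Tendsto (fun a => f (g a)) l (𝓝 (f x)) := by
  refine Iff.trans ?_ tendsto_pi_nhds
  exact (Topology.IsInducing.mk rfl : Topology.IsInducing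
    fun (z : WeakBilin (topDualPairing ℝ X).flip) f =>
      (topDualPairing ℝ X).flip z f).tendsto_nhds_iff

/-- Weak compactness in terms of ultrafilters on the original space. -/
theorem isCompact_image_toWeakSpace_iff {X : Type*} [NormedAddCommGroup X] [NormedSpace ℝ X]
    {s : Set X} :
    IsCompact (toWeakSpace ℝ X '' s) ↔
      ∀ V : Ultrafilter X, s ∈ V → ∃ x ∈ s, ∀ f : StrongDual ℝ X, Tendsto f V (𝓝 (f x)) := by
  rw [isCompact_iff_ultrafilter_le_nhds']
  constructor
  · intro h V hV
    obtain ⟨_, ⟨x, hx, rfl⟩, hle⟩ :=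
      h (V.map (toWeakSpace ℝ X)) (image_mem_map hV)
    exact ⟨x, hx, (tendsto_toWeakSpace_iff (g := id)).1 hle⟩
  · intro h U hU
    obtain ⟨x, hx, hf⟩ := h (U.map (toWeakSpace ℝ X).symm) (by
      filter_upwards [hU]
      rintro _ ⟨x, hx, rfl⟩
      exact hx)
    refine ⟨_, ⟨x, hx, rfl⟩, ?_⟩
    have := tendsto_toWeakSpace_iff.2 hf
    simpa [Tendsto, Filter.map_map, Function.comp_def] using this

/-- Weakly compact sets are norm bounded. -/
theorem isBounded_of_isCompact_toWeakSpace {X : Type*} [NormedAddCommGroup X] [NormedSpace ℝ X]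
    {s : Set X} (hs : IsCompact (toWeakSpace ℝ X '' s)) : Bornology.IsBounded s := by
  obtain ⟨C, hC⟩ := banach_steinhaus
    (g := fun x : s => NormedSpace.inclusionInDoubleDual ℝ X x) (by
      intro f
      have hf : Continuous fun z : WeakSpace ℝ X => f ((toWeakSpace ℝ X).symm z) :=
        WeakBilin.eval_continuous (topDualPairing ℝ X).flip f
      obtain ⟨C, hC⟩ := hs.exists_bound_of_continuousOn hf.continuousOn
      exact ⟨C, fun x => by simpa using hC _ ⟨x, x.2, rfl⟩⟩)
  refine isBounded_iff_forall_norm_le.2 ⟨C, fun x hx => ?_⟩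
  rw [← (NormedSpace.inclusionInDoubleDualLi (E := X) ℝ).norm_map x]
  exact hC ⟨x, hx⟩

/-- A finite linear combination of nonempty convex weakly compact sets is of the same kind. -/
theorem sum_smul_convex_weaklyCompact {ι X : Type*} [NormedAddCommGroup X] [NormedSpace ℝ X]
    (c : ι → ℝ) (G : ι → Set X) (hne : ∀ i, (G i).Nonempty) (hconv : ∀ i, Convex ℝ (G i))
    (hwk : ∀ i, IsCompact (toWeakSpace ℝ X '' G i)) (s : Finset ι) :
    (∑ i ∈ s, c i • G i).Nonempty ∧ Convex ℝ (∑ i ∈ s, c i • G i) ∧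
      IsCompact (toWeakSpace ℝ X '' ∑ i ∈ s, c i • G i) := by
  classical
  induction s using Finset.induction_on with
  | empty =>
    simp only [Finset.sum_empty]
    exact ⟨Set.zero_nonempty, convex_zero, by simp [← Set.singleton_zero]⟩
  | insert i s hi ih =>
    rw [Finset.sum_insert hi]
    refine ⟨((hne i).smul_set).add ih.1, ((hconv i).smul _).add ih.2.1, ?_⟩
    rw [Set.image_add, Set.image_smul_comm _ _ _ (map_smul (toWeakSpace ℝ X) _)]
    exact ((hwk i).smul _).add ih.2.2

/-- A closed set that is a Hausdorff limit of convex sets is convex. -/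
theorem convex_of_forall_exists_convex_close {X : Type*} [NormedAddCommGroup X] [NormedSpace ℝ X]
    {I : Set X} (hI : IsClosed I)
    (h : ∀ ε > (0 : ℝ), ∃ K : Set X, Convex ℝ K ∧
      (∀ x ∈ I, ∃ y ∈ K, dist x y < ε) ∧ ∀ y ∈ K, ∃ x ∈ I, dist y x < ε) :
    Convex ℝ I := by
  intro x hx y hy a b ha hb hab
  rw [← hI.closure_eq, Metric.mem_closure_iff]
  intro ε hε
  obtain ⟨K, hK, hIK, hKI⟩ := h (ε / 2) (half_pos hε)
  obtain ⟨x', hx', hxx'⟩ := hIK x hx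
  obtain ⟨y', hy', hyy'⟩ := hIK y hy
  obtain ⟨z, hz, hd⟩ := hKI _ (hK hx' hy' ha hb hab)
  refine ⟨z, hz, ?_⟩
  have hmid : a • x + b • y - (a • x' + b • y') ∈ ball (0 : X) (ε / 2) := by
    have := convex_ball (0 : X) (ε / 2) (x := x - x') (by simpa [dist_eq_norm] using hxx')
      (y := y - y') (by simpa [dist_eq_norm] using hyy') ha hb hab
    convert this using 1
    module
  rw [mem_ball_zero_iff, ← dist_eq_norm] at hmid
  linarith [dist_triangle (a • x + b • y) (a • x' + b • y') z]

/-- A closed set that is a Hausdorff limit of weakly compact sets is weakly compact. -/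
theorem weaklyCompact_of_forall_exists_weaklyCompact_close {X : Type*} [NormedAddCommGroup X]
    [NormedSpace ℝ X] [CompleteSpace X] {I : Set X} (hI : IsClosed I)
    (h : ∀ ε > (0 : ℝ), ∃ K : Set X, IsCompact (toWeakSpace ℝ X '' K) ∧
      (∀ x ∈ I, ∃ y ∈ K, dist x y < ε) ∧ ∀ y ∈ K, ∃ x ∈ I, dist y x < ε) :
    IsCompact (toWeakSpace ℝ X '' I) := by
  rw [isCompact_image_toWeakSpace_iff]
  intro V hV
  -- For each `ε`, `V` is weakly within `ε` of the weak limit of its projection to `K`.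
  have key : ∀ ε > (0 : ℝ), ∃ (k : X → X) (y : X), (∀ᶠ x in V, dist x (k x) < ε) ∧
      (∃ z ∈ I, dist y z < ε) ∧ ∀ f : StrongDual ℝ X, Tendsto (fun x => f (k x)) V (𝓝 (f y)) := by
    intro ε hε
    obtain ⟨K, hK, hIK, hKI⟩ := h ε hε
    choose! k hkK hk using hIK
    obtain ⟨y, hy, hlim⟩ := isCompact_image_toWeakSpace_iff.1 hK (V.map k)
      (Ultrafilter.mem_map.2 (mem_of_superset hV hkK))
    exact ⟨k, y, mem_of_superset hV hk, hKI y hy, hlim⟩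
  choose k y hk hyI hlim using fun n : ℕ => key (1 / ((n : ℝ) + 1)) Nat.one_div_pos_of_nat
  have hdist : ∀ n m, dist (y n) (y m) ≤ 1 / ((n : ℝ) + 1) + 1 / ((m : ℝ) + 1) := by
    intro n m
    rw [dist_eq_norm]
    refine NormedSpace.norm_le_dual_bound ℝ _ (by positivity) fun f => ?_
    have ht : Tendsto (fun x => ‖f (k n x - k m x)‖) V (𝓝 ‖f (y n - y m)‖) := by
      simpa only [map_sub] using ((hlim n f).sub (hlim m f)).norm
    refine le_of_tendsto ht ?_
    filter_upwards [hk n, hk m] with x hn hm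
    rw [mul_comm]
    refine f.le_opNorm_of_le ?_
    rw [← dist_eq_norm]
    linarith [dist_triangle_left (k n x) (k m x) x]
  have hzero := tendsto_one_div_add_atTop_nhds_zero_nat (𝕜 := ℝ)
  have hcauchy : CauchySeq y := by
    refine cauchySeq_of_le_tendsto_0 (fun N : ℕ => 1 / ((N : ℝ) + 1) + 1 / ((N : ℝ) + 1))
      (fun n m N hn hm => (hdist n m).trans ?_) (by simpa using hzero.add hzero)
    exact add_le_add (Nat.one_div_le_one_div hn) (Nat.one_div_le_one_div hm)
  obtain ⟨z, hz⟩ := cauchySeq_tendsto_of_complete hcauchy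
  refine ⟨z, ?_, fun f => ?_⟩
  · choose w hwI hw using hyI
    refine hI.mem_of_tendsto (tendsto_of_tendsto_of_dist hz ?_) (Eventually.of_forall hwI)
    exact squeeze_zero (fun _ => dist_nonneg) (fun n => (hw n).le) hzero
  · rw [Metric.tendsto_nhds]
    intro ε hε
    have hsmall : Tendsto (fun n : ℕ => ‖f‖ * (1 / ((n : ℝ) + 1)) + dist (f (y n)) (f z))
        atTop (𝓝 0) := by
      simpa using (hzero.const_mul ‖f‖).add
        (tendsto_iff_dist_tendsto_zero.1 ((f.continuous.tendsto z).comp hz))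
    obtain ⟨n, hn⟩ := (hsmall.eventually (gt_mem_nhds (half_pos hε))).exists
    filter_upwards [hk n, Metric.tendsto_nhds.1 (hlim n f) (ε / 2) (half_pos hε)] with x hx hfx
    have hfk : dist (f x) (f (k n x)) ≤ ‖f‖ * (1 / ((n : ℝ) + 1)) := by
      rw [dist_eq_norm, ← map_sub]
      exact f.le_opNorm_of_le (by simpa only [← dist_eq_norm] using hx.le)
    linarith [dist_triangle4 (f x) (f (k n x)) (f (y n)) (f z)]

/-- A Gould integral is a Hausdorff limit of convex weakly compact sets. -/
theorem GouldOn.exists_convex_weaklyCompact_close {T X : Type*} [NormedAddCommGroup X]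
    [NormedSpace ℝ X] {𝒜 : Set (Set T)} {μ : Set T → ℝ} {S : Set T} {F : T → Set X} {I : Set X}
    (hG : GouldOn 𝒜 μ S F I) (hFne : ∀ t, (F t).Nonempty) (hFconv : ∀ t, Convex ℝ (F t))
    (hFwk : ∀ t, IsCompact (toWeakSpace ℝ X '' F t))
    (hIne : I.Nonempty) (hIbd : Bornology.IsBounded I) {ε : ℝ} (hε : 0 < ε) :
    ∃ K : Set X, Convex ℝ K ∧ IsCompact (toWeakSpace ℝ X '' K) ∧
      (∀ x ∈ I, ∃ y ∈ K, dist x y < ε) ∧ ∀ y ∈ K, ∃ x ∈ I, dist y x < ε := by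
  obtain ⟨n, P, hP, h⟩ := hG ε hε
  choose t ht using hP.2.1
  have hlt := h n P hP (fun j => ⟨j, subset_rfl⟩) t ht
  obtain ⟨hne, hconv, hwk⟩ := sum_smul_convex_weaklyCompact (fun j => μ (P j)) (fun j => F (t j))
    (fun j => hFne _) (fun j => hFconv _) (fun j => hFwk _) Finset.univ
  rw [hausdorffDist_closure₁] at hlt
  have hfin := hausdorffEDist_ne_top_of_nonempty_of_bounded hne hIne
    (isBounded_of_isCompact_toWeakSpace hwk) hIbd
  refine ⟨_, hconv, hwk, fun x hx => ?_, fun y hy =>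
    exists_dist_lt_of_hausdorffDist_lt hy hlt hfin⟩
  obtain ⟨y, hy, hd⟩ := exists_dist_lt_of_hausdorffDist_lt' hx hlt hfin
  exact ⟨y, hy, by rwa [dist_comm]⟩

/-- If a multifunction with nonempty, convex, weakly compact values is Gould integrable,
then its Gould integral is convex and weakly compact. -/
theorem gould_integral_mem_cwk
    {T X : Type*} [Nonempty T] [NormedAddCommGroup X] [NormedSpace ℝ X] [CompleteSpace X]
    (𝒜 : Set (Set T)) (μ : Set T → ℝ)
    (h𝒜empty : ∅ ∈ 𝒜) (h𝒜univ : Set.univ ∈ 𝒜)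
    (h𝒜compl : ∀ A ∈ 𝒜, Aᶜ ∈ 𝒜) (h𝒜union : ∀ A ∈ 𝒜, ∀ B ∈ 𝒜, A ∪ B ∈ 𝒜)
    (hμ0 : μ ∅ = 0) (hμnn : ∀ A ∈ 𝒜, 0 ≤ μ A)
    (F : T → Set X) (hFne : ∀ t, (F t).Nonempty)
    (hFconv : ∀ t, Convex ℝ (F t))
    (hFwk : ∀ t, IsCompact (toWeakSpace ℝ X '' F t))
    (I : Set X) (hIne : I.Nonempty) (hIcl : IsClosed I) (hIbd : Bornology.IsBounded I)
    (hG : GouldOn 𝒜 μ Set.univ F I) :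
    Convex ℝ I ∧ IsCompact (toWeakSpace ℝ X '' I) := by
  constructor
  · refine convex_of_forall_exists_convex_close hIcl fun ε hε => ?_
    obtain ⟨K, hconv, -, hK⟩ :=
      hG.exists_convex_weaklyCompact_close hFne hFconv hFwk hIne hIbd hε
    exact ⟨K, hconv, hK⟩
  · refine weaklyCompact_of_forall_exists_weaklyCompact_close hIcl fun ε hε => ?_
    obtain ⟨K, -, hwk, hK⟩ :=
      hG.exists_convex_weaklyCompact_close hFne hFconv hFwk hIne hIbd hε
    exact ⟨K, hwk, hK⟩
end

section
/- Let T be a topological space, 𝒜 a σ-algebra of subsets of T containing the open sets, and μ a finite countably additive non-negative measure on 𝒜. Let Δ be a gauge on T and assume the Cousin property: every measurable set B ∈ 𝒜 admits a finite Δ-fine Mc Shane partition, i.e. finitely many pairwise disjoint measurable sets E'_1,…,E'_N with tags t'_j ∈ T, E'_j ⊆ Δ(t'_j), and μ(B ∖ ⋃_{j=1}^N E'_j) = 0. Let X be a Banach space, F : T → cwk(X) a bounded multifunction, P = {(E_i, t_i) : i ∈ ℕ} a Δ-fine generalized Mc Shane partition of T, and ε > 0. Then there exists a finite Δ-fine Mc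 Shane partition P' = {(E'_j, t'_j) : j = 1,…,N} of T such that limsup_n h(Σ_{i=1}^n F(t_i)·μ(E_i), Σ_{j=1}^N F(t'_j)·μ(E'_j)) ≤ 2ε. -/
open scoped Pointwise
open MeasureTheory Metric Filter

/-- A gauge on a topological space: an assignment of an open neighbourhood to each point. -/
def IsGauge {T : Type*} [TopologicalSpace T] (Δ : T → Set T) : Prop :=
  ∀ t, IsOpen (Δ t) ∧ t ∈ Δ t

/-- A generalized Mc Shane partition of `T`: a sequence of pairwise disjoint measurable
sets of finite measure, with free tags, covering `T` up to a `μ`-null set. -/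
def IsMcShanePart {T : Type*} [TopologicalSpace T] [MeasurableSpace T]
    (μ : Measure T) (E : ℕ → Set T) (tg : ℕ → T) : Prop :=
  (∀ i, MeasurableSet (E i)) ∧ (∀ i, μ (E i) < ⊤) ∧
    (Pairwise fun i j => Disjoint (E i) (E j)) ∧ μ (Set.univ \ ⋃ i, E i) = 0

/-- A finite `Δ`-fine Mc Shane partition of the measurable set `B`: finitely many
pairwise disjoint measurable sets with tags, each set contained in the gauge neighbourhood
of its tag, covering `B` up to a `μ`-null set. -/
def IsFinMcShanePartOf {T : Type*} [TopologicalSpace T] [MeasurableSpace T]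
    (μ : Measure T) (Δ : T → Set T) (B : Set T) {N : ℕ}
    (E : Fin N → Set T) (tg : Fin N → T) : Prop :=
  (∀ j, MeasurableSet (E j)) ∧ (Pairwise fun i j => Disjoint (E i) (E j)) ∧
    (∀ j, E j ⊆ Δ (tg j)) ∧ μ (B \ ⋃ j, E j) = 0

/-- A Riemann-type sum of sets bounded by `M` is bounded by `M` times the total weight. -/
theorem norm_le_of_mem_sum_smul {ι X : Type*} [NormedAddCommGroup X] [NormedSpace ℝ X]
    {s : Finset ι} {c : ι → ℝ} {G : ι → Set X} {M : ℝ} (hc : ∀ i ∈ s, 0 ≤ c i)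
    (hG : ∀ i ∈ s, ∀ x ∈ G i, ‖x‖ ≤ M) {x : X} (hx : x ∈ ∑ i ∈ s, c i • G i) :
    ‖x‖ ≤ (∑ i ∈ s, c i) * M := by
  obtain ⟨g, hg, rfl⟩ := (Set.mem_finsetSum _ _ _).1 hx
  rw [Finset.sum_mul]
  refine norm_sum_le_of_le s fun i hi => ?_
  obtain ⟨y, hy, hyg⟩ := hg hi
  rw [← hyg, norm_smul, Real.norm_of_nonneg (hc i hi)]
  exact mul_le_mul_of_nonneg_left (hG i hi y hy) (hc i hi)

theorem sum_smul_set_nonempty {ι X : Type*} [NormedAddCommGroup X] [NormedSpace ℝ X]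
    (s : Finset ι) (c : ι → ℝ) {G : ι → Set X} (hG : ∀ i, (G i).Nonempty) :
    (∑ i ∈ s, c i • G i).Nonempty := by
  choose g hg using hG
  exact ⟨∑ i ∈ s, c i • g i,
    (Set.mem_finsetSum _ _ _).2 ⟨fun i => c i • g i, fun {i} _ => Set.smul_mem_smul_set (hg i), rfl⟩⟩

/-- Adding two nonempty sets bounded by `ε` to a common set yields sets at Hausdorff distance
at most `2 * ε`. -/
theorem hausdorffDist_add_le {X : Type*} [NormedAddCommGroup X] {A R R' : Set X} {ε : ℝ}
    (hε : 0 ≤ ε) (hR : R.Nonempty) (hR' : R'.Nonempty)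
    (hRε : ∀ x ∈ R, ‖x‖ ≤ ε) (hR'ε : ∀ x ∈ R', ‖x‖ ≤ ε) :
    hausdorffDist (A + R) (A + R') ≤ 2 * ε := by
  have key : ∀ {B C : Set X}, C.Nonempty → (∀ x ∈ B, ‖x‖ ≤ ε) → (∀ x ∈ C, ‖x‖ ≤ ε) →
      ∀ x ∈ A + B, ∃ y ∈ A + C, dist x y ≤ 2 * ε := by
    rintro B C ⟨z, hz⟩ hB hC _ ⟨a, ha, b, hb, rfl⟩
    refine ⟨a + z, Set.add_mem_add ha hz, ?_⟩
    rw [dist_add_left, dist_eq_norm]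
    linarith [norm_sub_le b z, hB b hb, hC z hz]
  exact hausdorffDist_le_of_mem_dist (by positivity) (key hR' hRε hR'ε) (key hR hR'ε hRε)

/-- The part of the space not covered by the first `n` sets of a generalized Mc Shane partition
has measure tending to `0`. -/
theorem IsMcShanePart.tendsto_measureReal_compl {T : Type*} [TopologicalSpace T]
    [MeasurableSpace T] {μ : Measure T} [IsFiniteMeasure μ] {E : ℕ → Set T} {tg : ℕ → T}
    (hP : IsMcShanePart μ E tg) :
    Tendsto (fun n => μ.real (⋃ i ∈ Finset.range n, E i)ᶜ) atTop (nhds 0) := by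
  obtain ⟨hE, -, -, hcov⟩ := hP
  have hlim : Tendsto (fun n => μ (⋃ i ∈ Finset.range n, E i)ᶜ) atTop
      (nhds (μ (⋂ n, (⋃ i ∈ Finset.range n, E i)ᶜ))) := by
    refine tendsto_measure_iInter_atTop
      (fun n => (Finset.measurableSet_biUnion _ fun i _ => hE i).compl.nullMeasurableSet)
      (fun m n hmn => Set.compl_subset_compl.2 <|
        Set.biUnion_subset_biUnion_left fun i hi => ?_) ⟨0, measure_ne_top _ _⟩
    simp only [Finset.coe_range, Set.mem_Iio] at hi ⊢
    exact hi.trans_le hmn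
  have hnull : μ (⋂ n, (⋃ i ∈ Finset.range n, E i)ᶜ) = 0 := by
    refine measure_mono_null (fun x hx => ?_) hcov
    refine ⟨Set.mem_univ x, fun hxE => ?_⟩
    obtain ⟨i, hi⟩ := Set.mem_iUnion.1 hxE
    exact Set.mem_iInter.1 hx (i + 1) (Set.mem_biUnion (by simp) hi)
  rw [hnull] at hlim
  exact (ENNReal.tendsto_toReal ENNReal.zero_ne_top).comp hlim

/-- Disjoint measurable sets contained in `B` have total measure at most that of `B`. -/
theorem sum_measureReal_le_of_subset {ι T : Type*} [MeasurableSpace T] {μ : Measure T}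
    [IsFiniteMeasure μ] {s : Finset ι} {E : ι → Set T} {B : Set T}
    (hE : ∀ i, MeasurableSet (E i)) (hd : Pairwise fun i j => Disjoint (E i) (E j))
    (hB : ∀ i ∈ s, E i ⊆ B) : ∑ i ∈ s, μ.real (E i) ≤ μ.real B := by
  rw [← measureReal_biUnion_finset (fun i _ j _ hij => hd hij) fun i _ => hE i]
  exact measureReal_mono (Set.iUnion₂_subset hB)

/-- A finite `Δ`-fine partition of the complement of finitely many disjoint `Δ`-fine sets
can be appended to these sets to give a finite `Δ`-fine partition of the whole space. -/
theorem IsFinMcShanePartOf.append {T : Type*} [TopologicalSpace T] [MeasurableSpace T]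
    {μ : Measure T} {Δ : T → Set T} {n k : ℕ} {E : Fin n → Set T} {tg : Fin n → T}
    {E' : Fin k → Set T} {tg' : Fin k → T} (hE : ∀ i, MeasurableSet (E i))
    (hd : Pairwise fun i j => Disjoint (E i) (E j)) (hfine : ∀ i, E i ⊆ Δ (tg i))
    (h : IsFinMcShanePartOf μ Δ (⋃ i, E i)ᶜ E' tg') (hsub : ∀ j, E' j ⊆ (⋃ i, E i)ᶜ) :
    IsFinMcShanePartOf μ Δ Set.univ (Fin.append E E') (Fin.append tg tg') := by
  obtain ⟨hE', hd', hfine', hcov⟩ := h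
  have hcross : ∀ i j, Disjoint (E i) (E' j) := fun i j =>
    (disjoint_compl_right.mono_right (hsub j)).mono_left (Set.subset_iUnion E i)
  refine ⟨fun j => ?_, fun i j => ?_, fun j => ?_, measure_mono_null ?_ hcov⟩
  · induction j using Fin.addCases <;> simp [hE, hE']
  · induction i using Fin.addCases with
    | left i =>
      induction j using Fin.addCases with
      | left j => simpa using fun hij => hd (by rintro rfl; exact hij rfl)
      | right j => simpa using fun _ => hcross i j
    | right i =>
      induction j using Fin.addCases with
      | left j => simpa using fun _ => (hcross j i).symm
      | right j => simpa using fun hij => hd' (by rintro rfl; exact hij rfl)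
  · induction j using Fin.addCases <;> simp [hfine, hfine']
  · rintro x ⟨-, hx⟩
    simp only [Set.mem_iUnion, not_exists] at hx
    refine ⟨fun hxE => ?_, fun hxE => ?_⟩
    · obtain ⟨i, hi⟩ := Set.mem_iUnion.1 hxE
      exact hx (Fin.castAdd k i) (by simpa using hi)
    · obtain ⟨j, hj⟩ := Set.mem_iUnion.1 hxE
      exact hx (Fin.natAdd n j) (by simpa using hj)

/-- A finite `Δ`-fine partition of a measurable set may be cut down to lie inside that set. -/
theorem IsFinMcShanePartOf.inter {T : Type*} [TopologicalSpace T] [MeasurableSpace T]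
    {μ : Measure T} {Δ : T → Set T} {B : Set T} {N : ℕ} {E : Fin N → Set T} {tg : Fin N → T}
    (h : IsFinMcShanePartOf μ Δ B E tg) (hB : MeasurableSet B) :
    IsFinMcShanePartOf μ Δ B (fun j => E j ∩ B) tg := by
  obtain ⟨hE, hd, hfine, hcov⟩ := h
  refine ⟨fun j => (hE j).inter hB,
    fun i j hij => (hd hij).mono Set.inter_subset_left Set.inter_subset_left,
    fun j => Set.inter_subset_left.trans (hfine j), ?_⟩
  rwa [← Set.iUnion_inter, Set.sdiff_inter_self_eq_sdiff]

/-- Any `Δ`-fine generalized Mc Shane partition can be replaced, up to `2ε`, by a finite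
`Δ`-fine Mc Shane partition, provided every measurable set admits a finite `Δ`-fine
Mc Shane partition (Cousin property). -/
theorem finite_mcShane_approximation
    {T X : Type*} [Nonempty T] [TopologicalSpace T] [MeasurableSpace T]
    [OpensMeasurableSpace T] [NormedAddCommGroup X] [NormedSpace ℝ X] [CompleteSpace X]
    (μ : Measure T) [IsFiniteMeasure μ]
    (Δ : T → Set T) (hΔ : IsGauge Δ)
    (hCousin : ∀ B : Set T, MeasurableSet B →
      ∃ (N : ℕ) (E' : Fin N → Set T) (tg' : Fin N → T), IsFinMcShanePartOf μ Δ B E' tg')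
    (F : T → Set X) (hFne : ∀ t, (F t).Nonempty)
    (hFconv : ∀ t, Convex ℝ (F t))
    (hFwk : ∀ t, IsCompact (toWeakSpace ℝ X '' F t))
    (M : ℝ) (hM : ∀ t, ∀ x ∈ F t, ‖x‖ ≤ M)
    (E : ℕ → Set T) (tg : ℕ → T)
    (hP : IsMcShanePart μ E tg) (hfine : ∀ i, E i ⊆ Δ (tg i))
    (ε : ℝ) (hε : 0 < ε) :
    ∃ (N : ℕ) (E' : Fin N → Set T) (tg' : Fin N → T),
      IsFinMcShanePartOf μ Δ Set.univ E' tg' ∧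
      limsup (fun n => hausdorffDist
          (closure (∑ i ∈ Finset.range n, (μ (E i)).toReal • F (tg i)))
          (closure (∑ j, (μ (E' j)).toReal • F (tg' j)))) atTop ≤ 2 * ε := by
  obtain ⟨t₀⟩ := ‹Nonempty T›
  have hM0 : 0 ≤ M := (norm_nonneg _).trans (hM t₀ _ (hFne t₀).some_mem)
  have htail : Tendsto (fun n => μ.real (⋃ i ∈ Finset.range n, E i)ᶜ * M) atTop (nhds 0) := by
    simpa using hP.tendsto_measureReal_compl.mul_const M
  obtain ⟨n₀, hn₀⟩ := (htail.eventually (ge_mem_nhds hε)).exists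
  obtain ⟨hE, -, hd, -⟩ := hP
  set B : Set T := (⋃ i ∈ Finset.range n₀, E i)ᶜ with hBdef
  have hBm : MeasurableSet B := (Finset.measurableSet_biUnion _ fun i _ => hE i).compl
  have hBfin : (⋃ i : Fin n₀, E i)ᶜ = B := by
    ext x
    simp [hBdef, Fin.forall_iff]
  obtain ⟨k, E₁, tg₁, hpart⟩ := hCousin B hBm
  have hpart' := hpart.inter hBm
  refine ⟨n₀ + k, Fin.append (fun i : Fin n₀ => E i) (fun j => E₁ j ∩ B),
    Fin.append (fun i : Fin n₀ => tg i) tg₁,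
    IsFinMcShanePartOf.append (fun i => hE i) (fun i j hij => hd (Fin.val_ne_of_ne hij))
      (fun i => hfine i) (hBfin ▸ hpart') fun j => hBfin ▸ Set.inter_subset_right, ?_⟩
  refine limsup_le_of_le
    (isCoboundedUnder_le_of_le atTop (x := 0) fun n => hausdorffDist_nonneg) ?_
  filter_upwards [eventually_ge_atTop n₀] with n hn
  rw [hausdorffDist_closure, ← Finset.sum_range_add_sum_Ico _ hn, Fin.sum_univ_add]
  simp only [Fin.append_left, Fin.append_right]
  rw [Fin.sum_univ_eq_sum_range (fun i => (μ (E i)).toReal • F (tg i))]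
  refine hausdorffDist_add_le hε.le (sum_smul_set_nonempty _ _ fun i => hFne _)
    (sum_smul_set_nonempty _ _ fun i => hFne _) (fun x hx => ?_) fun x hx => ?_
  · refine (norm_le_of_mem_sum_smul (fun i _ => ENNReal.toReal_nonneg)
      (fun i _ => hM (tg i)) hx).trans (le_trans ?_ hn₀)
    refine mul_le_mul_of_nonneg_right (sum_measureReal_le_of_subset hE hd fun i hi => ?_) hM0
    refine Set.subset_compl_iff_disjoint_right.2 (Set.disjoint_iUnion₂_right.2 fun j hj => hd ?_)
    have := Finset.mem_Ico.1 hi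
    have := Finset.mem_range.1 hj
    lia
  · refine (norm_le_of_mem_sum_smul (fun i _ => ENNReal.toReal_nonneg)
      (fun i _ => hM (tg₁ i)) hx).trans (le_trans ?_ hn₀)
    exact mul_le_mul_of_nonneg_right (sum_measureReal_le_of_subset hpart'.1 hpart'.2.1
      fun i _ => Set.inter_subset_right) hM0
end
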